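/- Let ρ_{AB}, σ_{AB} be positive definite density matrices on a bipartite finite-dimensional Hilbert space H_A ⊗ H_B with marginals ρ_A, σ_A. If ρ_{AB} = σ_{AB}^{1/2}(σ_A^{-1/2} ρ_A σ_A^{-1/2} ⊗ 1_B) σ_{AB}^{1/2} (perfect Petz recovery), then for every α ∈ (−1,0) ∪ (0,1), the sandwiched Rényi divergence satisfies D̃_α(ρ_{AB}‖σ_{AB}) = D̃_α(ρ_A‖σ_A). -/

import Mathlib

open Matrix ComplexOrder

/-- Real power of a (Hermitian, in practice positive definite) matrix via spectral calculus. -/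
noncomputable def mpow {m : Type*} [Fintype m] [DecidableEq m]
    (A : Matrix m m ℂ) (r : ℝ) : Matrix m m ℂ :=
  if h : A.IsHermitian then
    (h.eigenvectorUnitary : Matrix m m ℂ) *
      Matrix.diagonal (fun i => ((h.eigenvalues i ^ r : ℝ) : ℂ)) *
      star (h.eigenvectorUnitary : Matrix m m ℂ)
  else A

/-- Partial trace over the second tensor factor. -/
noncomputable def ptraceB {a b : Type*} [Fintype b] (M : Matrix (a × b) (a × b) ℂ) :
    Matrix a a ℂ :=
  Matrix.of fun i j => ∑ k, M (i, k) (j, k)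

/-- Sandwiched Rényi divergence
`D̃_α(ρ‖σ) = ((1−α)/α) log Tr[(ρ^{1/2} σ^{−α} ρ^{1/2})^{1/(1−α)}]`. -/
noncomputable def sandD {m : Type*} [Fintype m] [DecidableEq m]
    (α : ℝ) (ρ σ : Matrix m m ℂ) : ℝ :=
  ((1 - α)/α) * Real.log
    ((mpow (mpow ρ (1/2) * mpow σ (-α) * mpow ρ (1/2)) (1/(1 - α))).trace.re)


section helpers
set_option linter.unusedSectionVars false
open Kronecker

/-- exponential monomials -/
noncomputable def expMon : Multiplicative ℝ →* (ℝ → ℂ) where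
  toFun x := fun t => Complex.exp ((x.toAdd : ℂ) * t)
  map_one' := by ext t; simp
  map_mul' x y := by ext t; simp [add_mul, Complex.exp_add]

noncomputable def expAlg : Subalgebra ℂ (ℝ → ℂ) :=
  Algebra.adjoin ℂ (MonoidHom.mrange expMon : Set (ℝ → ℂ))

theorem expAlg_eq_zero (f : ℝ → ℂ) (hf : f ∈ expAlg) (h : ∀ n : ℕ, f n = 0) : f = 0 := by
  have h1 : f ∈ Submodule.span ℂ (Set.range expMon) := by
    have := Algebra.adjoin_eq_span ℂ (MonoidHom.mrange expMon : Set (ℝ → ℂ))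
    rw [Submonoid.closure_eq] at this
    have h2 : f ∈ Subalgebra.toSubmodule expAlg := hf
    rw [expAlg, this] at h2
    simpa using h2
  rw [Finsupp.mem_span_range_iff_exists_finsupp] at h1
  obtain ⟨c, hc⟩ := h1
  let g : Multiplicative ℝ → (Multiplicative ℕ →* ℂ) := fun x =>
    (powersHom ℂ) (Complex.exp (x.toAdd : ℂ))
  have hg : Function.Injective g := by
    intro x y hxy
    have h3 : Complex.exp (x.toAdd : ℂ) = Complex.exp (y.toAdd : ℂ) := (powersHom ℂ).injective hxy
    rw [← Complex.ofReal_exp, ← Complex.ofReal_exp] at h3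
    have h4 := Real.exp_injective (Complex.ofReal_injective h3)
    exact h4
  have hli := (linearIndependent_monoidHom (Multiplicative ℕ) ℂ).comp g hg
  have hc0 : c = 0 := by
    rw [linearIndependent_iff] at hli
    apply hli
    ext n
    have h5 := h n.toAdd
    rw [← hc] at h5
    rw [Finsupp.linearCombination_apply]
    simp only [Finsupp.sum, Finset.sum_apply, Pi.smul_apply, smul_eq_mul] at h5 ⊢
    rw [Pi.zero_apply, ← h5]
    apply Finset.sum_congr rfl
    intro x _
    simp [g, expMon, powersHom_apply, ← Complex.exp_nat_mul, mul_comm]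
  rw [← hc, hc0]; simp

theorem expAlg_eq (f g : ℝ → ℂ) (hf : f ∈ expAlg) (hg : g ∈ expAlg) (h : ∀ n : ℕ, f n = g n) :
    f = g := by
  have := expAlg_eq_zero (f - g) (sub_mem hf hg) (fun n => by simp [h n])
  exact sub_eq_zero.mp this

theorem expAlg_rpow (b c : ℝ) (hb : 0 < b) : (fun t : ℝ => ((b ^ (c * t) : ℝ) : ℂ)) ∈ expAlg := by
  apply Algebra.subset_adjoin
  refine ⟨Multiplicative.ofAdd (Real.log b * c), ?_⟩
  ext t
  simp [expMon, Real.rpow_def_of_pos hb, mul_assoc]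

theorem expAlg_const (c : ℂ) : (fun _ : ℝ => c) ∈ expAlg := expAlg.algebraMap_mem c

/-- matrix valued functions with entries in the algebra -/
def EM {m n : Type*} (F : ℝ → Matrix m n ℂ) : Prop := ∀ i j, (fun t => F t i j) ∈ expAlg

theorem EM.const {m n : Type*} (M : Matrix m n ℂ) : EM (fun _ => M) := fun _ _ => expAlg_const _

theorem EM.mul {m n k : Type*} [Fintype n] {F : ℝ → Matrix m n ℂ} {G : ℝ → Matrix n k ℂ}
    (hF : EM F) (hG : EM G) : EM (fun t => F t * G t) := by
  intro i j
  have : (fun t => (F t * G t) i j) = ∑ l, (fun t => F t i l) * (fun t => G t l j) := by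
    ext t; simp [Matrix.mul_apply]
  rw [this]
  exact sum_mem fun l _ => mul_mem (hF i l) (hG l j)

theorem EM.kron {m n k : Type*} [DecidableEq k] {F : ℝ → Matrix m n ℂ}
    (hF : EM F) : EM (fun t => F t ⊗ₖ (1 : Matrix k k ℂ)) := by
  intro i j
  exact mul_mem (hF i.1 j.1) (expAlg_const _)

theorem EM.eq {m n : Type*} {F G : ℝ → Matrix m n ℂ} (hF : EM F) (hG : EM G)
    (h : ∀ n : ℕ, F n = G n) (t : ℝ) : F t = G t := by
  ext i j
  exact congrFun (expAlg_eq _ _ (hF i j) (hG i j) (fun n => by rw [h n])) t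

variable {m : Type*} [Fintype m] [DecidableEq m]

theorem mpow_eq {A : Matrix m m ℂ} (h : A.IsHermitian) (r : ℝ) : mpow A r =
    (h.eigenvectorUnitary : Matrix m m ℂ) *
      Matrix.diagonal (fun i => ((h.eigenvalues i ^ r : ℝ) : ℂ)) *
      star (h.eigenvectorUnitary : Matrix m m ℂ) := by
  rw [mpow, dif_pos h]

theorem EM.of_mpow {A : Matrix m m ℂ} (hA : A.PosDef) (c : ℝ) : EM (fun t => mpow A (c * t)) := by
  simp only [mpow_eq hA.1]
  refine EM.mul (EM.mul (EM.const _) ?_) (EM.const _)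
  intro i j
  by_cases h : i = j
  · subst h; simpa using expAlg_rpow _ c (hA.eigenvalues_pos i)
  · simpa [h] using expAlg_const 0

theorem mpow_add {A : Matrix m m ℂ} (hA : A.PosDef) (r s : ℝ) :
    mpow A r * mpow A s = mpow A (r + s) := by
  simp only [mpow_eq hA.1]
  have hU : star (hA.1.eigenvectorUnitary : Matrix m m ℂ) * (hA.1.eigenvectorUnitary : Matrix m m ℂ)
    = 1 := Unitary.coe_star_mul_self _
  have : ∀ U D V E : Matrix m m ℂ, V * U = 1 → (U * D * V) * (U * E * V) = U * (D * E) * V := by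
    intro U D V E h
    calc _ = U * D * (V * U) * E * V := by simp only [Matrix.mul_assoc]
      _ = _ := by rw [h]; simp only [Matrix.mul_assoc, Matrix.one_mul]
  rw [this _ _ _ _ hU, Matrix.diagonal_mul_diagonal]
  congr 3
  ext i
  rw [Real.rpow_add (hA.eigenvalues_pos i)]; simp

theorem mpow_zero {A : Matrix m m ℂ} (hA : A.PosDef) : mpow A 0 = 1 := by
  simp only [mpow_eq hA.1]
  simp

theorem mpow_one {A : Matrix m m ℂ} (hA : A.IsHermitian) : mpow A 1 = A := by
  have := hA.spectral_theorem
  rw [mpow_eq hA]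
  conv_rhs => rw [this]
  simp [Unitary.conjStarAlgAut_apply, Function.comp_def]

theorem mpow_herm {A : Matrix m m ℂ} (hA : A.IsHermitian) (r : ℝ) : (mpow A r)ᴴ = mpow A r := by
  simp only [mpow_eq hA, Matrix.conjTranspose_mul, Matrix.star_eq_conjTranspose,
    Matrix.conjTranspose_conjTranspose, Matrix.diagonal_conjTranspose, Matrix.mul_assoc]
  congr 3
  ext i; simp

theorem mpow_nat {A : Matrix m m ℂ} (hA : A.PosDef) (n : ℕ) : mpow A n = A ^ n := by
  induction n with
  | zero => simp [mpow_zero hA]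
  | succ k ih => rw [pow_succ, ← ih, Nat.cast_succ, ← mpow_add hA, mpow_one hA.1]

theorem mpow_trace {A : Matrix m m ℂ} (hA : A.IsHermitian) (r : ℝ) :
    (mpow A r).trace = (A.charpoly.roots.map (fun z : ℂ => ((z.re ^ r : ℝ) : ℂ))).sum := by
  rw [mpow_eq hA, Matrix.trace_mul_cycle, hA.roots_charpoly_eq_eigenvalues]
  have hU : star (hA.eigenvectorUnitary : Matrix m m ℂ) * (hA.eigenvectorUnitary : Matrix m m ℂ)
    = 1 := Unitary.coe_star_mul_self _
  rw [hU, Matrix.one_mul, Matrix.trace_diagonal]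
  rw [Multiset.map_map]
  simp [Function.comp_def]

theorem trace_swap {ρ σ : Matrix m m ℂ} (hρ : ρ.PosDef) (hσ : σ.PosDef) (α s : ℝ) :
    (mpow (mpow ρ (1/2) * mpow σ (-α) * mpow ρ (1/2)) s).trace
      = (mpow (mpow σ (-α/2) * ρ * mpow σ (-α/2)) s).trace := by
  have e1 : mpow ρ (1/2) * mpow σ (-α) * mpow ρ (1/2)
      = (mpow ρ (1/2) * mpow σ (-α/2)) * (mpow σ (-α/2) * mpow ρ (1/2)) := by
    have : mpow σ (-α) = mpow σ (-α/2) * mpow σ (-α/2) := by rw [mpow_add hσ]; congr 1; ring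
    rw [this]; simp only [Matrix.mul_assoc]
  have e2 : mpow σ (-α/2) * ρ * mpow σ (-α/2)
      = (mpow σ (-α/2) * mpow ρ (1/2)) * (mpow ρ (1/2) * mpow σ (-α/2)) := by
    have : ρ = mpow ρ (1/2) * mpow ρ (1/2) := by
      rw [mpow_add hρ]; norm_num; rw [mpow_one hρ.1]
    conv_lhs => rw [this]
    simp only [Matrix.mul_assoc]
  rw [e1, e2, mpow_trace, mpow_trace, Matrix.charpoly_mul_comm]
  · simp only [Matrix.IsHermitian, Matrix.conjTranspose_mul, mpow_herm hρ.1, mpow_herm hσ.1]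
  · simp only [Matrix.IsHermitian, Matrix.conjTranspose_mul, mpow_herm hρ.1, mpow_herm hσ.1]

theorem conj_posDef {ρ σ : Matrix m m ℂ} (hρ : ρ.PosDef) (hσ : σ.PosDef) (r : ℝ) :
    (mpow σ r * ρ * mpow σ r).PosDef := by
  have h : IsUnit (mpow σ r) := by
    have a : mpow σ r * mpow σ (-r) = 1 := by rw [mpow_add hσ]; simp [mpow_zero hσ]
    have b : mpow σ (-r) * mpow σ r = 1 := by rw [mpow_add hσ]; simp [mpow_zero hσ]
    exact ⟨⟨_, _, a, b⟩, rfl⟩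
  have := (Matrix.IsUnit.posDef_star_left_conjugate_iff h (x := ρ)).2 hρ
  rwa [Matrix.star_eq_conjTranspose, mpow_herm hσ.1] at this

variable {a b : Type*} [Fintype a] [Fintype b] [DecidableEq a] [DecidableEq b]

theorem ptrace_trace (M : Matrix (a × b) (a × b) ℂ) : (ptraceB M).trace = M.trace := by
  simp [Matrix.trace, ptraceB, Fintype.sum_prod_type]

theorem ptrace_mul_left (M : Matrix (a × b) (a × b) ℂ) (Y : Matrix a a ℂ) :
    ptraceB ((Y ⊗ₖ (1 : Matrix b b ℂ)) * M) = Y * ptraceB M := by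
  ext i j
  simp only [ptraceB, Matrix.of_apply, Matrix.mul_apply, Matrix.kroneckerMap_apply,
    Fintype.sum_prod_type, Matrix.one_apply, Finset.mul_sum]
  rw [Finset.sum_comm]
  simp

theorem ptrace_mul_right (M : Matrix (a × b) (a × b) ℂ) (Y : Matrix a a ℂ) :
    ptraceB (M * (Y ⊗ₖ (1 : Matrix b b ℂ))) = ptraceB M * Y := by
  ext i j
  simp only [ptraceB, Matrix.of_apply, Matrix.mul_apply, Matrix.kroneckerMap_apply,
    Fintype.sum_prod_type, Matrix.one_apply, Finset.sum_mul]
  rw [Finset.sum_comm]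
  simp

theorem ptrace_posDef [Nonempty b] {M : Matrix (a × b) (a × b) ℂ} (hM : M.PosDef) :
    (ptraceB M).PosDef := by
  have : ptraceB M = ∑ k, M.submatrix (fun i => (i, k)) (fun i => (i, k)) := by
    ext i j; simp [ptraceB, Matrix.sum_apply]
  rw [this]
  have hk : ∀ k : b, (M.submatrix (fun i : a => (i, k)) (fun i => (i, k))).PosDef := fun k =>
    hM.submatrix (fun x y h => by simpa using h)
  classical
  obtain ⟨k0⟩ := ‹Nonempty b›
  rw [← Finset.add_sum_erase _ _ (Finset.mem_univ k0)]
  exact (hk k0).add_posSemidef (Matrix.posSemidef_sum _ (fun k _ => (hk k).posSemidef))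

theorem ptrace_conjTranspose (M : Matrix (a × b) (a × b) ℂ) : ptraceB Mᴴ = (ptraceB M)ᴴ := by
  ext i j; simp [ptraceB, Matrix.conjTranspose_apply]

theorem kron_mul (X Y : Matrix a a ℂ) :
    (X * Y) ⊗ₖ (1 : Matrix b b ℂ) = (X ⊗ₖ 1) * (Y ⊗ₖ (1 : Matrix b b ℂ)) := by
  rw [← Matrix.mul_kronecker_mul, Matrix.one_mul]

theorem kron_conjTranspose (X : Matrix a a ℂ) :
    (X ⊗ₖ (1 : Matrix b b ℂ))ᴴ = Xᴴ ⊗ₖ (1 : Matrix b b ℂ) := by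
  rw [Matrix.conjTranspose_kronecker, Matrix.conjTranspose_one]

theorem step_eq {S s : Matrix (a × b) (a × b) ℂ} {p q Y : Matrix a a ℂ}
    (hs : sᴴ = s) (hss : s * s = S) (hp : pᴴ = p) (hq : qᴴ = q) (hpp : p * p = ptraceB S)
    (hpq : p * q = 1) (hqp : q * p = 1)
    (h : ptraceB (s * (Y ⊗ₖ (1 : Matrix b b ℂ)) * s) = p * Y * p) :
    s * (Y ⊗ₖ (1 : Matrix b b ℂ)) = ((p * Y * q) ⊗ₖ (1 : Matrix b b ℂ)) * s := by
  have h' : ptraceB (s * (Yᴴ ⊗ₖ (1 : Matrix b b ℂ)) * s) = p * Yᴴ * p := by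
    have := congrArg Matrix.conjTranspose h
    rw [← ptrace_conjTranspose] at this
    simpa only [Matrix.conjTranspose_mul, hs, hp, kron_conjTranspose, Matrix.mul_assoc] using this
  rw [← sub_eq_zero, ← Matrix.trace_mul_conjTranspose_self_eq_zero_iff]
  simp only [Matrix.conjTranspose_sub, Matrix.conjTranspose_mul, hs, hp, hq, kron_conjTranspose]
  have t1 : (s * (Y ⊗ₖ (1 : Matrix b b ℂ)) * ((Yᴴ ⊗ₖ (1 : Matrix b b ℂ)) * s)).trace
      = (p * Y * Yᴴ * p).trace := by
    rw [Matrix.trace_mul_comm, Matrix.mul_assoc, ← Matrix.mul_assoc s s, hss, ← ptrace_trace,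
      ptrace_mul_left, ptrace_mul_right, ← hpp, Matrix.trace_mul_comm]
    simp only [Matrix.mul_assoc]
    rw [Matrix.trace_mul_comm p]
    simp only [Matrix.mul_assoc]
  have t2 : (s * (Y ⊗ₖ (1 : Matrix b b ℂ)) * (s * ((q * (Yᴴ * p)) ⊗ₖ (1 : Matrix b b ℂ)))).trace
      = (p * Y * Yᴴ * p).trace := by
    rw [← Matrix.mul_assoc, ← ptrace_trace, ptrace_mul_right, h]
    congr 1
    calc _ = p * Y * (p * q) * Yᴴ * p := by simp only [Matrix.mul_assoc]
      _ = _ := by rw [hpq, Matrix.mul_one]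
  have t3 : (((p * Y * q) ⊗ₖ (1 : Matrix b b ℂ)) * s * ((Yᴴ ⊗ₖ (1 : Matrix b b ℂ)) * s)).trace
      = (p * Y * Yᴴ * p).trace := by
    rw [Matrix.mul_assoc, ← Matrix.mul_assoc s, ← ptrace_trace, ptrace_mul_left, h']
    congr 1
    calc _ = p * Y * (q * p) * Yᴴ * p := by simp only [Matrix.mul_assoc]
      _ = _ := by rw [hqp, Matrix.mul_one]
  have t4 : (((p * Y * q) ⊗ₖ (1 : Matrix b b ℂ)) * s *
      (s * ((q * (Yᴴ * p)) ⊗ₖ (1 : Matrix b b ℂ)))).trace = (p * Y * Yᴴ * p).trace := by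
    rw [Matrix.mul_assoc, ← Matrix.mul_assoc s, hss, ← ptrace_trace, ptrace_mul_left,
      ptrace_mul_right, ← hpp]
    congr 1
    calc _ = p * Y * (q * p) * (p * q) * Yᴴ * p := by simp only [Matrix.mul_assoc]
      _ = _ := by rw [hpq, hqp, Matrix.mul_one, Matrix.mul_one]
  rw [Matrix.sub_mul, Matrix.mul_sub, Matrix.mul_sub, Matrix.trace_sub, Matrix.trace_sub,
    Matrix.trace_sub, t1, t2, t3, t4]
  ring

theorem step_next {S s : Matrix (a × b) (a × b) ℂ} {p q Y : Matrix a a ℂ}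
    (hss : s * s = S) (hpp : p * p = ptraceB S) (hqp : q * p = 1)
    (h : s * (Y ⊗ₖ (1 : Matrix b b ℂ)) = ((p * Y * q) ⊗ₖ (1 : Matrix b b ℂ)) * s) :
    ptraceB (s * ((p * Y * q) ⊗ₖ (1 : Matrix b b ℂ)) * s) = p * (p * Y * q) * p := by
  rw [Matrix.mul_assoc, ← h, ← Matrix.mul_assoc, hss, ptrace_mul_right, ← hpp]
  calc _ = p * p * Y * (q * p) := by rw [hqp, Matrix.mul_one]
    _ = _ := by simp only [Matrix.mul_assoc]

theorem mpow_add_neg {A : Matrix m m ℂ} (hA : A.PosDef) (r : ℝ) : mpow A r * mpow A (-r) = 1 := by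
  rw [mpow_add hA]; simp [mpow_zero hA]

theorem mpow_neg_add {A : Matrix m m ℂ} (hA : A.PosDef) (r : ℝ) : mpow A (-r) * mpow A r = 1 := by
  rw [mpow_add hA]; simp [mpow_zero hA]

theorem mpow_half {A : Matrix m m ℂ} (hA : A.PosDef) : mpow A (1/2) * mpow A (1/2) = A := by
  rw [mpow_add hA]; norm_num; exact mpow_one hA.1

theorem modular_nat {S : Matrix (a × b) (a × b) ℂ} {X : Matrix a a ℂ} (hS : S.PosDef)
    (hA : (ptraceB S).PosDef)
    (h : ptraceB (mpow S (1/2) * (X ⊗ₖ (1 : Matrix b b ℂ)) * mpow S (1/2))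
      = mpow (ptraceB S) (1/2) * X * mpow (ptraceB S) (1/2)) (n : ℕ) :
    ptraceB (mpow S (1/2) * ((mpow (ptraceB S) (1/2 * n) * X * mpow (ptraceB S) (-(1/2) * n))
        ⊗ₖ (1 : Matrix b b ℂ)) * mpow S (1/2))
      = mpow (ptraceB S) (1/2) * (mpow (ptraceB S) (1/2 * n) * X * mpow (ptraceB S) (-(1/2) * n))
        * mpow (ptraceB S) (1/2) ∧
    mpow S (1/2 * n) * (X ⊗ₖ (1 : Matrix b b ℂ)) * mpow S (-(1/2) * n)
      = (mpow (ptraceB S) (1/2 * n) * X * mpow (ptraceB S) (-(1/2) * n)) ⊗ₖ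
        (1 : Matrix b b ℂ) := by
  induction n with
  | zero => simpa [mpow_zero hS, mpow_zero hA] using h
  | succ n ih =>
    obtain ⟨ih1, ih2⟩ := ih
    have e := step_eq (mpow_herm hS.1 _) (mpow_half hS) (mpow_herm hA.1 _) (mpow_herm hA.1 (-(1/2)))
      (mpow_half hA) (mpow_add_neg hA _) (mpow_neg_add hA _) ih1
    have e2 := step_next (mpow_half hS) (mpow_half hA) (mpow_neg_add hA _) e
    have e3 : mpow (ptraceB S) (1/2 * (n + 1 : ℕ)) * X * mpow (ptraceB S) (-(1/2) * (n + 1 : ℕ))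
      = mpow (ptraceB S) (1/2) * (mpow (ptraceB S) (1/2 * n) * X * mpow (ptraceB S) (-(1/2) * n))
        * mpow (ptraceB S) (-(1/2)) := by
      have a1 : (1/2 * ((n + 1 : ℕ) : ℝ) : ℝ) = 1/2 + 1/2 * n := by push_cast; ring
      have a2 : (-(1/2) * ((n + 1 : ℕ) : ℝ) : ℝ) = -(1/2) * n + -(1/2) := by push_cast; ring
      rw [a1, a2, ← mpow_add hA, ← mpow_add hA]
      simp only [Matrix.mul_assoc]
    rw [e3]
    refine ⟨e2, ?_⟩
    have a1 : (1/2 * ((n + 1 : ℕ) : ℝ) : ℝ) = 1/2 + 1/2 * n := by push_cast; ring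
    have a2 : (-(1/2) * ((n + 1 : ℕ) : ℝ) : ℝ) = -(1/2) * n + -(1/2) := by push_cast; ring
    rw [a1, a2, ← mpow_add hS, ← mpow_add hS]
    rw [← ih2] at e
    calc _ = mpow S (1/2) * (mpow S (1/2 * n) * (X ⊗ₖ (1 : Matrix b b ℂ)) * mpow S (-(1/2) * n))
          * mpow S (-(1/2)) := by simp only [Matrix.mul_assoc]
      _ = _ := by rw [e, Matrix.mul_assoc, mpow_add_neg hS, Matrix.mul_one]

theorem modular_real {S : Matrix (a × b) (a × b) ℂ} {X : Matrix a a ℂ} (hS : S.PosDef)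
    (hA : (ptraceB S).PosDef)
    (h : ptraceB (mpow S (1/2) * (X ⊗ₖ (1 : Matrix b b ℂ)) * mpow S (1/2))
      = mpow (ptraceB S) (1/2) * X * mpow (ptraceB S) (1/2)) (t : ℝ) :
    mpow S t * (X ⊗ₖ (1 : Matrix b b ℂ))
      = ((mpow (ptraceB S) t * X * mpow (ptraceB S) (-t)) ⊗ₖ (1 : Matrix b b ℂ)) * mpow S t := by
  have := EM.eq (((EM.of_mpow hS (1/2)).mul (EM.const (X ⊗ₖ (1 : Matrix b b ℂ)))).mul
      (EM.of_mpow hS (-(1/2))))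
    (((EM.of_mpow hA (1/2)).mul (EM.const X)).mul (EM.of_mpow hA (-(1/2)))).kron
    (fun n => (modular_nat hS hA h n).2) (2 * t)
  have a1 : 1/2 * (2 * t) = t := by ring
  have a2 : -(1/2) * (2 * t) = -t := by ring
  simp only [a1, a2] at this
  rw [← this, Matrix.mul_assoc, mpow_neg_add hS, Matrix.mul_one]

theorem cocycle_nat {S : Matrix (a × b) (a × b) ℂ} {X : Matrix a a ℂ} (hS : S.PosDef)
    (hA : (ptraceB S).PosDef)
    (h : ptraceB (mpow S (1/2) * (X ⊗ₖ (1 : Matrix b b ℂ)) * mpow S (1/2))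
      = mpow (ptraceB S) (1/2) * X * mpow (ptraceB S) (1/2)) (g : ℝ) (n : ℕ) :
    (mpow S g * (X ⊗ₖ (1 : Matrix b b ℂ)) * mpow S g) ^ n
      = (((mpow (ptraceB S) g * X * mpow (ptraceB S) g) ^ n * mpow (ptraceB S) (-(2*g) * n)) ⊗ₖ
        (1 : Matrix b b ℂ)) * mpow S (2 * g * n) := by
  induction n with
  | zero => simp [mpow_zero hS, mpow_zero hA]
  | succ n ih =>
    have m1 := modular_real hS hA h ((2 * n + 1) * g)
    have b1 : mpow S (2 * g * n) * mpow S g = mpow S ((2 * n + 1) * g) := by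
      rw [mpow_add hS]; congr 1; ring
    have b2 : mpow S ((2 * n + 1) * g) * mpow S g = mpow S (2 * g * (n + 1 : ℕ)) := by
      rw [mpow_add hS]; congr 1; push_cast; ring
    have b3 : mpow (ptraceB S) (-(2*g) * n) * mpow (ptraceB S) ((2 * n + 1) * g)
        = mpow (ptraceB S) g := by
      rw [mpow_add hA]; congr 1; ring
    have b4 : mpow (ptraceB S) (-((2 * n + 1) * g))
        = mpow (ptraceB S) g * mpow (ptraceB S) (-(2*g) * (n + 1 : ℕ)) := by
      rw [mpow_add hA]; congr 1; push_cast; ring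
    rw [pow_succ, ih]
    calc _ = (((mpow (ptraceB S) g * X * mpow (ptraceB S) g) ^ n * mpow (ptraceB S) (-(2*g) * n)) ⊗ₖ
        (1 : Matrix b b ℂ)) * ((mpow S (2 * g * n) * mpow S g) * (X ⊗ₖ (1 : Matrix b b ℂ)))
          * mpow S g := by
          simp only [Matrix.mul_assoc]
      _ = (((mpow (ptraceB S) g * X * mpow (ptraceB S) g) ^ n * mpow (ptraceB S) (-(2*g) * n)) ⊗ₖ
        (1 : Matrix b b ℂ)) * ((mpow (ptraceB S) ((2 * n + 1) * g) * X *
          mpow (ptraceB S) (-((2 * n + 1) * g))) ⊗ₖ (1 : Matrix b b ℂ))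
          * (mpow S ((2 * n + 1) * g) * mpow S g) := by
          rw [b1, m1]; simp only [Matrix.mul_assoc]
      _ = _ := by
          rw [b2, ← kron_mul]
          congr 2
          rw [b4, pow_succ]
          calc _ = (mpow (ptraceB S) g * X * mpow (ptraceB S) g) ^ n *
                (mpow (ptraceB S) (-(2*g) * n) * mpow (ptraceB S) ((2 * n + 1) * g)) * X *
                mpow (ptraceB S) g * mpow (ptraceB S) (-(2*g) * (n + 1 : ℕ)) := by
                  simp only [Matrix.mul_assoc]
            _ = _ := by rw [b3]; simp only [Matrix.mul_assoc]

theorem trace_eq {S : Matrix (a × b) (a × b) ℂ} {X : Matrix a a ℂ} (hS : S.PosDef)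
    (hA : (ptraceB S).PosDef)
    (h : ptraceB (mpow S (1/2) * (X ⊗ₖ (1 : Matrix b b ℂ)) * mpow S (1/2))
      = mpow (ptraceB S) (1/2) * X * mpow (ptraceB S) (1/2)) (g : ℝ) (hg : g ≠ 0)
    (hT : (mpow S g * (X ⊗ₖ (1 : Matrix b b ℂ)) * mpow S g).PosDef)
    (hTA : (mpow (ptraceB S) g * X * mpow (ptraceB S) g).PosDef) :
    (mpow (mpow S g * (X ⊗ₖ (1 : Matrix b b ℂ)) * mpow S g) (1/(2*g))).trace =
    (mpow (mpow (ptraceB S) g * X * mpow (ptraceB S) g) (1/(2*g))).trace := by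
  have := EM.eq (EM.of_mpow hT 1)
    (((EM.of_mpow hTA 1).mul (EM.of_mpow hA (-(2*g)))).kron.mul (EM.of_mpow hS (2*g)))
    (fun n => by simpa only [one_mul, mpow_nat hT, mpow_nat hTA] using cocycle_nat hS hA h g n)
    (1/(2*g))
  have a1 : 2 * g * (1/(2*g)) = 1 := by field_simp
  have a2 : -(2 * g) * (1/(2*g)) = -1 := by field_simp
  simp only [one_mul, a1, a2, mpow_one hS.1] at this
  rw [this, ← ptrace_trace, ptrace_mul_left]
  have e : mpow (ptraceB S) (-1) * ptraceB S = 1 := by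
    have := mpow_neg_add hA 1
    rwa [mpow_one hA.1] at this
  rw [Matrix.mul_assoc, e, Matrix.mul_one]

end helpers

open Kronecker in
/-- Perfect Petz recovery implies saturation of the DPI for the sandwiched Rényi
divergence, for every `α ∈ (−1,0) ∪ (0,1)`. -/
theorem petz_recovery_implies_dpi_equality {nA nB : ℕ}
    (ρAB σAB : Matrix (Fin nA × Fin nB) (Fin nA × Fin nB) ℂ)
    (hρ : ρAB.PosDef) (hσ : σAB.PosDef) (hρ1 : ρAB.trace = 1) (hσ1 : σAB.trace = 1)
    (hrec : ρAB = mpow σAB (1/2) *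
      ((mpow (ptraceB σAB) (-(1/2)) * ptraceB ρAB * mpow (ptraceB σAB) (-(1/2))) ⊗ₖ
        (1 : Matrix (Fin nB) (Fin nB) ℂ)) * mpow σAB (1/2))
    (α : ℝ) (hα : α ∈ Set.Ioo (-1:ℝ) 1) (hα0 : α ≠ 0) :
    sandD α ρAB σAB = sandD α (ptraceB ρAB) (ptraceB σAB) := by
  have hα1 : α < 1 := hα.2
  haveI : Nonempty (Fin nB) := by
    by_contra hne
    rw [not_nonempty_iff] at hne
    rw [Matrix.trace, Fintype.sum_empty] at hσ1
    exact zero_ne_one hσ1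
  have hA := ptrace_posDef hσ
  have hR := ptrace_posDef hρ
  unfold sandD
  rw [trace_swap hρ hσ, trace_swap hR hA]
  set X := mpow (ptraceB σAB) (-(1/2)) * ptraceB ρAB * mpow (ptraceB σAB) (-(1/2)) with hX
  have hRX : ptraceB ρAB = mpow (ptraceB σAB) (1/2) * X * mpow (ptraceB σAB) (1/2) := by
    rw [hX]
    calc _ = (mpow (ptraceB σAB) (1/2) * mpow (ptraceB σAB) (-(1/2))) * ptraceB ρAB *
          (mpow (ptraceB σAB) (-(1/2)) * mpow (ptraceB σAB) (1/2)) := by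
            rw [mpow_add_neg hA, mpow_neg_add hA, Matrix.one_mul, Matrix.mul_one]
      _ = _ := by simp only [Matrix.mul_assoc]
  have h : ptraceB (mpow σAB (1/2) * (X ⊗ₖ (1 : Matrix (Fin nB) (Fin nB) ℂ)) * mpow σAB (1/2))
      = mpow (ptraceB σAB) (1/2) * X * mpow (ptraceB σAB) (1/2) := by
    rw [← hrec]; exact hRX
  have k1 : mpow σAB (-α/2) * ρAB * mpow σAB (-α/2) = mpow σAB ((1-α)/2) *
      (X ⊗ₖ (1 : Matrix (Fin nB) (Fin nB) ℂ)) * mpow σAB ((1-α)/2) := by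
    have c1 : mpow σAB ((1-α)/2) = mpow σAB (-α/2) * mpow σAB (1/2) := by
      rw [mpow_add hσ]; congr 1; ring
    have c2 : mpow σAB ((1-α)/2) = mpow σAB (1/2) * mpow σAB (-α/2) := by
      rw [mpow_add hσ]; congr 1; ring
    calc _ = mpow σAB (-α/2) * (mpow σAB (1/2) * (X ⊗ₖ (1 : Matrix (Fin nB) (Fin nB) ℂ)) *
          mpow σAB (1/2)) * mpow σAB (-α/2) := by rw [← hrec]
      _ = (mpow σAB (-α/2) * mpow σAB (1/2)) * (X ⊗ₖ (1 : Matrix (Fin nB) (Fin nB) ℂ)) *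
          (mpow σAB (1/2) * mpow σAB (-α/2)) := by simp only [Matrix.mul_assoc]
      _ = _ := by rw [← c1, ← c2]
  have k2 : mpow (ptraceB σAB) (-α/2) * ptraceB ρAB * mpow (ptraceB σAB) (-α/2) =
      mpow (ptraceB σAB) ((1-α)/2) * X * mpow (ptraceB σAB) ((1-α)/2) := by
    have c1 : mpow (ptraceB σAB) ((1-α)/2) = mpow (ptraceB σAB) (-α/2) * mpow (ptraceB σAB) (1/2) := by
      rw [mpow_add hA]; congr 1; ring
    have c2 : mpow (ptraceB σAB) ((1-α)/2) = mpow (ptraceB σAB) (1/2) * mpow (ptraceB σAB) (-α/2) := by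
      rw [mpow_add hA]; congr 1; ring
    calc _ = mpow (ptraceB σAB) (-α/2) * (mpow (ptraceB σAB) (1/2) * X *
          mpow (ptraceB σAB) (1/2)) * mpow (ptraceB σAB) (-α/2) := by rw [← hRX]
      _ = (mpow (ptraceB σAB) (-α/2) * mpow (ptraceB σAB) (1/2)) * X *
          (mpow (ptraceB σAB) (1/2) * mpow (ptraceB σAB) (-α/2)) := by simp only [Matrix.mul_assoc]
      _ = _ := by rw [← c1, ← c2]
  have p1 := conj_posDef hρ hσ (-α/2)
  have p2 := conj_posDef hR hA (-α/2)
  rw [k1] at p1 ⊢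
  rw [k2] at p2 ⊢
  have hg : (1 - α)/2 ≠ 0 := by
    have : 0 < (1 - α)/2 := by linarith
    exact this.ne'
  have key := trace_eq hσ hA h ((1-α)/2) hg p1 p2
  have e : 2 * ((1-α)/2) = 1 - α := by ring
  rw [e] at key
  rw [key]
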